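/- (Twin Simplification) Let G=(V,E_L,E_R) be an achievement positional game and let u,v∈V be distinct vertices such that {u},{v}∉E_L∪E_R and, for every edge e∈E_L∪E_R, u∈e if and only if v∈e. Then the updated games G_u^v and G_v^u coincide, and letting G' denote this game, o(G')=o(G). -/

import Mathlib

namespace APG

/-- The two players: Left and Right. -/
inductive Player : Type
  | L : Player
  | R : Player
deriving DecidableEq, Repr

/-- The opponent of a player. -/
def Player.other : Player → Player
  | .L => .R
  | .R => .L

/-- An achievement positional game: a finite vertex set together with the set of
blue edges (Left's winning sets) and the set of red edges (Right's winning sets). -/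
structure Game : Type where
  V : Finset ℕ
  EL : Finset (Finset ℕ)
  ER : Finset (Finset ℕ)

/-- The edges are nonempty subsets of the vertex set. -/
def WellFormed (G : Game) : Prop :=
  (∀ e ∈ G.EL, e ⊆ G.V ∧ e.Nonempty) ∧ (∀ e ∈ G.ER, e ⊆ G.V ∧ e.Nonempty)

/-- The winning sets of a given player. -/
def Game.edges (G : Game) : Player → Finset (Finset ℕ)
  | .L => G.EL
  | .R => G.ER

/-- The player who makes the `i`-th move (0-indexed) when `s` moves first. -/
def mover (s : Player) (i : ℕ) : Player := if i % 2 = 0 then s else s.other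

/-- The set of vertices picked by player `p` along the history `h`
(the chronological list of the moves played so far), when `s` moved first. -/
def picked (s p : Player) (h : List ℕ) : Finset ℕ :=
  ((Finset.range h.length).filter fun i => mover s i = p).image fun i => h.getD i 0

/-- The set `S` of picked vertices fills some edge of `E`. -/
def fills (E : Finset (Finset ℕ)) (S : Finset ℕ) : Prop := ∃ e ∈ E, e ⊆ S

/-- The game is over: some player has picked all the vertices of one of their edges. -/
def ended (G : Game) (s : Player) (h : List ℕ) : Prop :=
  fills G.EL (picked s .L h) ∨ fills G.ER (picked s .R h)

/-- `h` is a legal history: no vertex is picked twice, every picked vertex belongs to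
the board, and no move is made after the game has ended. -/
def ValidHist (G : Game) (s : Player) (h : List ℕ) : Prop :=
  h.Nodup ∧ (∀ x ∈ h, x ∈ G.V) ∧ ∀ k, k < h.length → ¬ ended G s (h.take k)

/-- A strategy: a map assigning to each position (history) a vertex to pick. -/
abbrev Strategy := List ℕ → ℕ

/-- Along `h`, every move of player `p` agrees with the strategy `σ`. -/
def Follows (s p : Player) (σ : Strategy) (h : List ℕ) : Prop :=
  ∀ k, k < h.length → mover s k = p → h.getD k 0 = σ (h.take k)

/-- A finished play: either the game has ended or all vertices have been picked. -/
def Complete (G : Game) (s : Player) (h : List ℕ) : Prop :=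
  ended G s h ∨ h.length = G.V.card

/-- The strategy `σ` of player `p` always suggests a legal move (an unpicked vertex)
whenever the game is not over and it is `p`'s turn. -/
def Legal (G : Game) (s p : Player) (σ : Strategy) : Prop :=
  ∀ h, ValidHist G s h → Follows s p σ h → ¬ ended G s h → h.length < G.V.card →
    mover s h.length = p → σ h ∈ G.V ∧ σ h ∉ h

/-- Player `p` has a winning strategy on `G` when `s` moves first: following it,
every finished play ends with `p` having filled one of their edges (and, the game
having ended right there, the opponent has not filled an edge first). -/
def WinsAs (G : Game) (s p : Player) : Prop :=
  ∃ σ : Strategy, Legal G s p σ ∧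
    ∀ h, ValidHist G s h → Follows s p σ h → Complete G s h →
      fills (G.edges p) (picked s p h)

/-- Player `p` has a non-losing strategy on `G` when `s` moves first: following it,
the opponent never fills one of their edges. -/
def NonLosingAs (G : Game) (s p : Player) : Prop :=
  ∃ σ : Strategy, Legal G s p σ ∧
    ∀ h, ValidHist G s h → Follows s p σ h → Complete G s h →
      ¬ fills (G.edges p.other) (picked s p.other h)

/-- The possible results of the game, for a fixed starting player. -/
inductive Result : Type
  | Lwin : Result
  | draw : Result
  | Rwin : Result
deriving DecidableEq, Repr

/-- The result of `G` with optimal play, when `s` moves first, is `r`: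
a win for a player means that player has a winning strategy, a draw means
both players have non-losing strategies. -/
def resultIs (G : Game) (s : Player) : Result → Prop
  | .Lwin => WinsAs G s .L
  | .Rwin => WinsAs G s .R
  | .draw => NonLosingAs G s .L ∧ NonLosingAs G s .R

/-- An outcome: the pair of results with optimal play
(when Left starts, when Right starts). -/
abbrev Outcome := Result × Result

/-- `G` has outcome `o`. -/
def hasOutcome (G : Game) (o : Outcome) : Prop :=
  resultIs G .L o.1 ∧ resultIs G .R o.2

/-- Numerical value of a result, from Left's point of view:
Right wins < draw < Left wins. -/
def Result.val : Result → ℕ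
  | .Rwin => 0
  | .draw => 1
  | .Lwin => 2

/-- The partial order `≤_L` on outcomes, comparing both components simultaneously
from Left's point of view. -/
def outLE (o o' : Outcome) : Prop := o.1.val ≤ o'.1.val ∧ o.2.val ≤ o'.2.val

def oL : Outcome := (.Lwin, .Lwin)
def oLminus : Outcome := (.Lwin, .draw)
def oN : Outcome := (.Lwin, .Rwin)
def oD : Outcome := (.draw, .draw)
def oRminus : Outcome := (.draw, .Rwin)
def oR : Outcome := (.Rwin, .Rwin)

/-- The updated game `G_u` after Left has picked `u`. -/
def subL (G : Game) (u : ℕ) : Game where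
  V := G.V.erase u
  EL := G.EL.image fun e => e.erase u
  ER := G.ER.filter fun e => u ∉ e

/-- The updated game `G^u` after Right has picked `u`. -/
def subR (G : Game) (u : ℕ) : Game where
  V := G.V.erase u
  EL := G.EL.filter fun e => u ∉ e
  ER := G.ER.image fun e => e.erase u

/-- The updated game `G_u^v` after Left has picked `u` and Right has picked `v`. -/
def updLR (G : Game) (u v : ℕ) : Game where
  V := (G.V.erase u).erase v
  EL := (G.EL.filter fun e => v ∉ e).image fun e => e.erase u
  ER := (G.ER.filter fun e => u ∉ e).image fun e => e.erase v

/-- The disjoint union of two games. -/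
def gunion (G G' : Game) : Game where
  V := G.V ∪ G'.V
  EL := G.EL ∪ G'.EL
  ER := G.ER ∪ G'.ER

theorem Player.other_other (p : Player) : p.other.other = p := by cases p <;> rfl

theorem mover_succ (s : Player) (n : ℕ) : mover s (n + 1) = (mover s n).other := by
  unfold mover
  rcases Nat.mod_two_eq_zero_or_one n with h | h
  · simp [h, Nat.succ_mod_two_eq_one_iff.2 h]
  · simp [h, Nat.succ_mod_two_eq_zero_iff.2 h, Player.other_other]

theorem picked_nil (s p : Player) : picked s p [] = ∅ := by simp [picked]

theorem picked_append (s p : Player) (h : List ℕ) (x : ℕ) :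
    picked s p (h ++ [x]) =
      if mover s h.length = p then insert x (picked s p h) else picked s p h := by
  have key : (((Finset.range h.length).filter fun i => mover s i = p).image
      fun i => (h ++ [x]).getD i 0) = picked s p h := by
    refine Finset.image_congr fun i hi => ?_
    have hi' : i < h.length := by simpa using (Finset.mem_filter.1 hi).1
    exact List.getD_append _ _ _ _ hi'
  unfold picked at key ⊢
  rw [List.length_append, List.length_singleton, Finset.range_add_one, Finset.filter_insert]
  split_ifs with hm
  · rw [Finset.image_insert, key]
    simp
  · exact key

theorem mem_iff_mem_picked (s p : Player) (h : List ℕ) (x : ℕ) :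
    x ∈ h ↔ x ∈ picked s p h ∪ picked s p.other h := by
  induction h using List.reverseRecOn with
  | nil => simp [picked_nil]
  | append_singleton h y ih =>
    rw [picked_append, picked_append, List.mem_append, ih]
    generalize mover s h.length = q
    cases p <;> cases q <;> simp [Player.other] <;> tauto

theorem ended_iff (G : Game) (s p : Player) (h : List ℕ) :
    ended G s h ↔
      fills (G.edges p) (picked s p h) ∨ fills (G.edges p.other) (picked s p.other h) := by
  cases p
  · rfl
  · exact or_comm

theorem validHist_append {G : Game} {s : Player} {h : List ℕ} {x : ℕ} :
    ValidHist G s (h ++ [x]) ↔ ValidHist G s h ∧ ¬ ended G s h ∧ x ∈ G.V ∧ x ∉ h := by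
  have hk : (∀ k, k < (h ++ [x]).length → ¬ ended G s ((h ++ [x]).take k)) ↔
      (∀ k, k < h.length → ¬ ended G s (h.take k)) ∧ ¬ ended G s h := by
    constructor
    · refine fun H => ⟨fun k hk => ?_, ?_⟩
      · simpa [List.take_append_of_le_length hk.le] using
          H k (by rw [List.length_append]; omega)
      · simpa using H h.length (by simp)
    · rintro ⟨H, H'⟩ k hk
      rw [List.length_append, List.length_singleton] at hk
      rw [List.take_append_of_le_length (by omega)]
      rcases (Nat.lt_succ_iff_lt_or_eq.1 hk) with hk | rfl
      · exact H k hk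
      · simpa using H'
  unfold ValidHist
  rw [hk, ← List.concat_eq_append, List.nodup_concat]
  simp only [List.concat_eq_append, List.mem_append, List.mem_singleton, or_imp, forall_and,
    forall_eq]
  tauto

theorem follows_append {s p : Player} {σ : Strategy} {h : List ℕ} {x : ℕ} :
    Follows s p σ (h ++ [x]) ↔ Follows s p σ h ∧ (mover s h.length = p → x = σ h) := by
  constructor
  · refine fun H => ⟨fun k hk hm => ?_, fun hm => ?_⟩
    · have := H k (by rw [List.length_append]; omega) hm
      rwa [List.getD_append _ _ _ _ hk, List.take_append_of_le_length hk.le] at this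
    · simpa using H h.length (by simp) hm
  · rintro ⟨H, H'⟩ k hk hm
    rw [List.length_append, List.length_singleton] at hk
    rw [List.take_append_of_le_length (by omega)]
    rcases (Nat.lt_succ_iff_lt_or_eq.1 hk) with hk | rfl
    · rw [List.getD_append _ _ _ _ hk]
      exact H k hk hm
    · simpa using H' hm

theorem validHist_nil (G : Game) (s : Player) : ValidHist G s [] := by simp [ValidHist]

theorem follows_nil (s p : Player) (σ : Strategy) : Follows s p σ [] := by simp [Follows]

/-- A player owning `A`, whose opponent owns `B`, can force the play on the board `V` to stop in
a position satisfying `P`, where the play stops at positions satisfying `T` and after at most `n`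
further moves. The Boolean tells whether the player is the next one to move. -/
def Force (V : Finset ℕ) (T P : Finset ℕ → Finset ℕ → Prop) :
    ℕ → Bool → Finset ℕ → Finset ℕ → Prop
  | 0, _, A, B => P A B
  | n + 1, true, A, B =>
      (T A B ∧ P A B) ∨ (¬ T A B ∧ ∃ x ∈ V, x ∉ A ∪ B ∧ Force V T P n false (insert x A) B)
  | n + 1, false, A, B =>
      (T A B ∧ P A B) ∨ (¬ T A B ∧ ∀ x ∈ V, x ∉ A ∪ B → Force V T P n true A (insert x B))

theorem force_of_terminal {V : Finset ℕ} {T P : Finset ℕ → Finset ℕ → Prop} {A B : Finset ℕ}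
    (hT : T A B) (n : ℕ) (t : Bool) : Force V T P n t A B ↔ P A B := by
  cases n <;> cases t <;> simp [Force, hT]

/-- Determinacy of the forcing game. -/
theorem not_force_iff (V : Finset ℕ) (T P : Finset ℕ → Finset ℕ → Prop) (n : ℕ) (t : Bool)
    (A B : Finset ℕ) :
    ¬ Force V T P n t A B ↔
      Force V (fun A B => T B A) (fun A B => ¬ P B A) n (!t) B A := by
  induction n generalizing t A B with
  | zero => simp [Force]
  | succ n ih =>
    by_cases hT : T A B
    · rw [force_of_terminal hT, force_of_terminal (T := fun A B => T B A) hT]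
    · cases t
      · simp [Force, hT, ih, and_comm, and_assoc]
      · simp only [Force, hT, false_and, false_or, not_false_eq_true, true_and, not_exists,
          not_and, ih, Bool.not_true, Bool.not_false, Finset.union_comm A B]

/-- Strategies on histories are as strong as forcing on positions. -/
theorem exists_strategy_iff_force (G : Game) (s p : Player) (T P : Finset ℕ → Finset ℕ → Prop)
    (hT : ∀ h, ended G s h ↔ T (picked s p h) (picked s p.other h)) :
    (∃ σ : Strategy, Legal G s p σ ∧ ∀ h, ValidHist G s h → Follows s p σ h → Complete G s h →
      P (picked s p h) (picked s p.other h)) ↔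
    Force G.V T P G.V.card (decide (s = p)) ∅ ∅ := by
  have mine : ∀ h x, mover s h.length = p →
      picked s p (h ++ [x]) = insert x (picked s p h) ∧
      picked s p.other (h ++ [x]) = picked s p.other h ∧ mover s (h ++ [x]).length ≠ p := by
    intro h x hm
    rw [picked_append, picked_append, List.length_append, List.length_singleton, mover_succ, hm]
    cases p <;> simp [Player.other]
  have theirs : ∀ h x, mover s h.length ≠ p →
      picked s p (h ++ [x]) = picked s p h ∧
      picked s p.other (h ++ [x]) = insert x (picked s p.other h) ∧
      mover s (h ++ [x]).length = p := by
    intro h x hm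
    rw [picked_append, picked_append, List.length_append, List.length_singleton, mover_succ]
    generalize mover s h.length = q at *
    cases p <;> cases q <;> simp_all [Player.other]
  have length_le : ∀ h, ValidHist G s h → h.length ≤ G.V.card := by
    intro h hh
    rw [← List.toFinset_card_of_nodup hh.1]
    exact Finset.card_le_card fun x hx => hh.2.1 x (List.mem_toFinset.1 hx)
  constructor
  · rintro ⟨σ, hσ, hP⟩
    have key : ∀ n h, ValidHist G s h → Follows s p σ h → h.length + n = G.V.card →
        Force G.V T P n (decide (mover s h.length = p)) (picked s p h) (picked s p.other h) := by
      intro n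
      induction n with
      | zero => exact fun h hv hf hl => hP h hv hf (Or.inr hl)
      | succ n ih =>
        intro h hv hf hl
        by_cases he : ended G s h
        · exact (force_of_terminal ((hT h).1 he) _ _).2 (hP h hv hf (Or.inl he))
        have hT' : ¬ T (picked s p h) (picked s p.other h) := fun h' => he ((hT h).2 h')
        by_cases hm : mover s h.length = p
        · obtain ⟨hx, hxh⟩ := hσ h hv hf he (by omega) hm
          have := ih (h ++ [σ h]) (validHist_append.2 ⟨hv, he, hx, hxh⟩)
            (follows_append.2 ⟨hf, fun _ => rfl⟩) (by rw [List.length_append]; simp; omega)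
          obtain ⟨h1, h2, h3⟩ := mine h (σ h) hm
          rw [h1, h2, decide_eq_false h3] at this
          rw [decide_eq_true hm]
          exact Or.inr ⟨hT', σ h, hx, (mem_iff_mem_picked s p h _).not.1 hxh, this⟩
        · rw [decide_eq_false hm]
          refine Or.inr ⟨hT', fun x hx hxh => ?_⟩
          rw [← mem_iff_mem_picked s p h] at hxh
          have := ih (h ++ [x]) (validHist_append.2 ⟨hv, he, hx, hxh⟩)
            (follows_append.2 ⟨hf, fun h' => absurd h' hm⟩)
            (by rw [List.length_append]; simp; omega)
          obtain ⟨h1, h2, h3⟩ := theirs h x hm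
          rwa [h1, h2, decide_eq_true h3] at this
    simpa [picked_nil, mover] using
      key G.V.card [] (validHist_nil G s) (follows_nil s p σ) (by simp)
  · intro H
    classical
    let good (h : List ℕ) (x : ℕ) : Prop := x ∈ G.V ∧ x ∉ picked s p h ∪ picked s p.other h ∧
      Force G.V T P (G.V.card - (h.length + 1)) false (insert x (picked s p h))
        (picked s p.other h)
    let σ : Strategy := fun h => if hx : ∃ x, good h x then hx.choose else 0
    have σ_good : ∀ h, (∃ x, good h x) → good h (σ h) := by
      intro h hx
      simp only [σ, dif_pos hx]
      exact hx.choose_spec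
    have good_of_force : ∀ h, ¬ ended G s h → h.length < G.V.card → mover s h.length = p →
        Force G.V T P (G.V.card - h.length) (decide (mover s h.length = p)) (picked s p h)
          (picked s p.other h) → good h (σ h) := by
      intro h he hl hm hF
      rw [decide_eq_true hm, show G.V.card - h.length = G.V.card - (h.length + 1) + 1 by omega]
        at hF
      rcases hF with ⟨h', -⟩ | ⟨-, x, hx⟩
      · exact absurd ((hT h).2 h') he
      · exact σ_good h ⟨x, hx⟩
    have key : ∀ h, ValidHist G s h → Follows s p σ h →
        Force G.V T P (G.V.card - h.length) (decide (mover s h.length = p)) (picked s p h)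
          (picked s p.other h) := by
      intro h
      induction h using List.reverseRecOn with
      | nil => exact fun _ _ => by simpa [picked_nil, mover] using H
      | append_singleton h x ih =>
        intro hv hf
        have hl := length_le _ hv
        rw [List.length_append, List.length_singleton] at hl
        obtain ⟨hv, he, hx, hxh⟩ := validHist_append.1 hv
        obtain ⟨hf, hxσ⟩ := follows_append.1 hf
        have hF := ih hv hf
        by_cases hm : mover s h.length = p
        · obtain ⟨h1, h2, h3⟩ := mine h x hm
          rw [h1, h2, decide_eq_false h3, hxσ hm, List.length_append, List.length_singleton]
          exact (good_of_force h he (by omega) hm hF).2.2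
        · obtain ⟨h1, h2, h3⟩ := theirs h x hm
          rw [h1, h2, decide_eq_true h3, List.length_append, List.length_singleton]
          rw [decide_eq_false hm,
            show G.V.card - h.length = G.V.card - (h.length + 1) + 1 by omega] at hF
          rcases hF with ⟨h', -⟩ | ⟨-, hF⟩
          · exact absurd ((hT h).2 h') he
          · exact hF x hx ((mem_iff_mem_picked s p h x).not.1 hxh)
    refine ⟨σ, fun h hv hf he hl hm => ?_, fun h hv hf hc => ?_⟩
    · obtain ⟨hx, hxh, -⟩ := good_of_force h he hl hm (key h hv hf)
      exact ⟨hx, (mem_iff_mem_picked s p h _).not.2 hxh⟩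
    · have hF := key h hv hf
      rcases hc with he | hl
      · exact (force_of_terminal ((hT h).1 he) _ _).1 hF
      · rw [hl, Nat.sub_self] at hF
        exact hF

/-- The position is over: one of the two edge sets is filled. -/
def Over (E F : Finset (Finset ℕ)) (A B : Finset ℕ) : Prop := fills E A ∨ fills F B

theorem winsAs_iff_force (G : Game) (s p : Player) :
    WinsAs G s p ↔ Force G.V (Over (G.edges p) (G.edges p.other))
      (fun A _ => fills (G.edges p) A) G.V.card (decide (s = p)) ∅ ∅ :=
  exists_strategy_iff_force G s p _ (fun A _ => fills (G.edges p) A) (ended_iff G s p)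

theorem nonLosingAs_iff_force (G : Game) (s p : Player) :
    NonLosingAs G s p ↔ Force G.V (Over (G.edges p) (G.edges p.other))
      (fun _ B => ¬ fills (G.edges p.other) B) G.V.card (decide (s = p)) ∅ ∅ :=
  exists_strategy_iff_force G s p _ (fun _ B => ¬ fills (G.edges p.other) B) (ended_iff G s p)

/-- A player has a winning strategy unless the opponent has a non-losing one. -/
theorem not_winsAs_iff (G : Game) (s p : Player) : ¬ WinsAs G s p ↔ NonLosingAs G s p.other := by
  have hT : (fun A B => Over (G.edges p) (G.edges p.other) B A) =
      Over (G.edges p.other) (G.edges p) := by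
    funext A B
    exact propext or_comm
  have ht : (!decide (s = p)) = decide (s = p.other) := by cases s <;> cases p <;> rfl
  rw [winsAs_iff_force, not_force_iff, nonLosingAs_iff_force, Player.other_other, hT, ht]

/-- `X` does not distinguish owning at most one of the twins `u`, `v` from owning none, in
which case it agrees with `X'`. -/
def TwinInvariant (u v : ℕ) (X X' : Finset ℕ → Finset ℕ → Prop) : Prop :=
  ∀ ⦃A B A₁ B₁ : Finset ℕ⦄, u ∉ A → v ∉ A → u ∉ B → v ∉ B →
    (A₁ = A ∨ A₁ = insert u A ∨ A₁ = insert v A) →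
    (B₁ = B ∨ B₁ = insert u B ∨ B₁ = insert v B) → (X A₁ B₁ ↔ X' A B)

theorem TwinInvariant.swap {u v : ℕ} {X X' : Finset ℕ → Finset ℕ → Prop}
    (hX : TwinInvariant u v X X') : TwinInvariant v u X X' :=
  fun _ _ _ _ h1 h2 h3 h4 hA hB => hX h2 h1 h4 h3 (by tauto) (by tauto)

theorem force_split_twins {V : Finset ℕ} {u v : ℕ} {T P T' P' : Finset ℕ → Finset ℕ → Prop}
    (hT : TwinInvariant u v T T') (hP : TwinInvariant u v P P') (n : ℕ) (t : Bool)
    {A B : Finset ℕ} (huA : u ∉ A) (hvA : v ∉ A) (huB : u ∉ B) (hvB : v ∉ B)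
    (H : Force ((V.erase u).erase v) T' P' n t A B) :
    Force V T P n t (insert u A) (insert v B) := by
  induction n generalizing t A B with
  | zero => exact (hP huA hvA huB hvB (by simp) (by simp)).2 H
  | succ n ih =>
    have hT := hT huA hvA huB hvB (A₁ := insert u A) (B₁ := insert v B) (by simp) (by simp)
    have hP := hP huA hvA huB hvB (A₁ := insert u A) (B₁ := insert v B) (by simp) (by simp)
    cases t
    · rcases H with ⟨h1, h2⟩ | ⟨h1, h2⟩
      · exact Or.inl ⟨hT.2 h1, hP.2 h2⟩
      · refine Or.inr ⟨fun h => h1 (hT.1 h), fun x hx hxh => ?_⟩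
        simp only [Finset.mem_union, Finset.mem_insert, not_or] at hxh
        obtain ⟨⟨hxu, hxA⟩, hxv, hxB⟩ := hxh
        rw [Finset.insert_comm]
        exact ih true huA hvA (by simp [huB, Ne.symm hxu]) (by simp [hvB, Ne.symm hxv])
          (h2 x (by simp [hx, hxu, hxv]) (by simp [hxA, hxB]))
    · rcases H with ⟨h1, h2⟩ | ⟨h1, x, hx, hxh, h2⟩
      · exact Or.inl ⟨hT.2 h1, hP.2 h2⟩
      · simp only [Finset.mem_erase] at hx
        simp only [Finset.mem_union, not_or] at hxh
        obtain ⟨hxv, hxu, hx⟩ := hx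
        refine Or.inr ⟨fun h => h1 (hT.1 h), x, hx, by simp [hxu, hxv, hxh], ?_⟩
        rw [Finset.insert_comm]
        exact ih false (by simp [huA, Ne.symm hxu]) (by simp [hvA, Ne.symm hxv]) huB hvB h2

/-- The player answers a move on one twin by a move on the other. -/
theorem force_of_force_erase_twins {V : Finset ℕ} {u v : ℕ}
    {T P T' P' : Finset ℕ → Finset ℕ → Prop}
    (hT : TwinInvariant u v T T') (hP : TwinInvariant u v P P')
    (hu : u ∈ V) (hv : v ∈ V) (huv : u ≠ v) (n : ℕ) (t : Bool)
    {A B : Finset ℕ} (huA : u ∉ A) (hvA : v ∉ A) (huB : u ∉ B) (hvB : v ∉ B)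
    (hn : (((V.erase u).erase v) \ (A ∪ B)).card ≤ n)
    (H : Force ((V.erase u).erase v) T' P' n t A B) :
    Force V T P (n + 2) t A B := by
  have board_swap : (V.erase v).erase u = (V.erase u).erase v := Finset.erase_right_comm
  -- the answer to a move of the opponent on a twin
  have answer : ∀ n A B, u ∉ A → v ∉ A → u ∉ B → v ∉ B → ¬ T' A B →
      Force ((V.erase u).erase v) T' P' n false A B →
      Force V T P (n + 1) true A (insert u B) ∧ Force V T P (n + 1) true A (insert v B) := by
    intro n A B huA hvA huB hvB h H
    refine ⟨Or.inr ⟨?_, v, hv, by simp [hvA, hvB, huv.symm], ?_⟩,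
      Or.inr ⟨?_, u, hu, by simp [huA, huB, huv], ?_⟩⟩
    · rwa [hT huA hvA huB hvB (by simp) (by simp)]
    · exact force_split_twins hT.swap hP.swap n false hvA huA hvB huB (board_swap ▸ H)
    · rwa [hT huA hvA huB hvB (by simp) (by simp)]
    · exact force_split_twins hT hP n false huA hvA huB hvB H
  induction n generalizing t A B with
  | zero =>
    have hT0 := hT huA hvA huB hvB (.inl rfl) (.inl rfl)
    have hP0 := hP huA hvA huB hvB (.inl rfl) (.inl rfl)
    have full : ∀ x ∈ V, x ∉ A ∪ B → x = u ∨ x = v := by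
      intro x hx hxh
      by_contra hne
      rw [not_or] at hne
      have : x ∈ ((V.erase u).erase v) \ (A ∪ B) :=
        Finset.mem_sdiff.2 ⟨by simp [hx, hne], hxh⟩
      rw [Finset.card_eq_zero.1 (Nat.le_zero.1 hn)] at this
      simp at this
    by_cases h : T A B
    · exact (force_of_terminal h _ _).2 (hP0.2 H)
    cases t
    · refine Or.inr ⟨h, fun x hx hxh => ?_⟩
      have := answer 0 A B huA hvA huB hvB (fun h' => h (hT0.2 h')) H
      rcases full x hx hxh with rfl | rfl
      · exact this.1
      · exact this.2
    · refine Or.inr ⟨h, u, hu, by simp [huA, huB], Or.inr ⟨?_, fun x hx hxh => ?_⟩⟩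
      · rwa [hT huA hvA huB hvB (by simp) (by simp), ← hT0]
      · simp only [Finset.mem_union, Finset.mem_insert, not_or] at hxh
        rcases full x hx (by simp [hxh]) with rfl | rfl
        · exact absurd rfl hxh.1.1
        · exact (hP huA hvA huB hvB (by simp) (by simp)).2 H
  | succ n ih =>
    have hT0 := hT huA hvA huB hvB (.inl rfl) (.inl rfl)
    have hP0 := hP huA hvA huB hvB (.inl rfl) (.inl rfl)
    have card_le : ∀ x ∈ (V.erase u).erase v, x ∉ A ∪ B →
        (((V.erase u).erase v) \ insert x (A ∪ B)).card ≤ n := by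
      intro x hx hxh
      rw [Finset.sdiff_insert, Finset.card_erase_of_mem (Finset.mem_sdiff.2 ⟨hx, hxh⟩)]
      omega
    by_cases h : T A B
    · exact (force_of_terminal h _ _).2 (hP0.2 ((force_of_terminal (hT0.1 h) _ _).1 H))
    have h' : ¬ T' A B := fun h' => h (hT0.2 h')
    cases t
    · refine Or.inr ⟨h, fun x hx hxh => ?_⟩
      by_cases hxu : x = u
      · exact hxu ▸ (answer (n + 1) A B huA hvA huB hvB h' H).1
      by_cases hxv : x = v
      · exact hxv ▸ (answer (n + 1) A B huA hvA huB hvB h' H).2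
      have hx' : x ∈ (V.erase u).erase v := by simp [hx, hxu, hxv]
      refine ih true huA hvA (by simp [huB, Ne.symm hxu]) (by simp [hvB, Ne.symm hxv]) ?_ ?_
      · rw [Finset.union_insert]
        exact card_le x hx' hxh
      · exact (H.resolve_left fun hh => h' hh.1).2 x hx' hxh
    · obtain ⟨x, hx', hxh, H⟩ := (H.resolve_left fun hh => h' hh.1).2
      obtain ⟨hxv, hxu, hx⟩ : x ≠ v ∧ x ≠ u ∧ x ∈ V := by simpa using hx'
      refine Or.inr ⟨h, x, hx, hxh, ih false (by simp [huA, Ne.symm hxu])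
        (by simp [hvA, Ne.symm hxv]) huB hvB ?_ H⟩
      rw [Finset.insert_union]
      exact card_le x hx' hxh

theorem image_erase_filter_twins {E : Finset (Finset ℕ)} {u v : ℕ}
    (h : ∀ e ∈ E, u ∈ e ↔ v ∈ e) :
    (E.filter fun e => v ∉ e).image (fun e => e.erase u) = E.filter fun e => u ∉ e := by
  ext e
  simp only [Finset.mem_image, Finset.mem_filter]
  constructor
  · rintro ⟨e, ⟨he, hve⟩, rfl⟩
    have hue := (h e he).not.2 hve
    rw [Finset.erase_eq_of_notMem hue]
    exact ⟨he, hue⟩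
  · rintro ⟨he, hue⟩
    exact ⟨e, ⟨he, (h e he).not.1 hue⟩, Finset.erase_eq_of_notMem hue⟩

theorem fills_filter_twins {E : Finset (Finset ℕ)} {u v : ℕ} (huv : u ≠ v)
    (h : ∀ e ∈ E, u ∈ e ↔ v ∈ e) {A A₁ : Finset ℕ} (hu : u ∉ A) (hv : v ∉ A)
    (hA : A₁ = A ∨ A₁ = insert u A ∨ A₁ = insert v A) :
    fills E A₁ ↔ fills (E.filter fun e => u ∉ e) A := by
  constructor
  · rintro ⟨e, he, heA⟩
    have hue : u ∉ e := by
      intro hue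
      have h1 := heA hue
      have h2 := heA ((h e he).1 hue)
      rcases hA with rfl | rfl | rfl <;> simp_all [huv.symm]
    have hve := (h e he).not.1 hue
    refine ⟨e, Finset.mem_filter.2 ⟨he, hue⟩, fun x hx => ?_⟩
    have hxu : x ≠ u := fun h' => hue (h' ▸ hx)
    have hxv : x ≠ v := fun h' => hve (h' ▸ hx)
    have := heA hx
    rcases hA with rfl | rfl | rfl <;> simp_all
  · rintro ⟨e, he, heA⟩
    refine ⟨e, (Finset.mem_filter.1 he).1, heA.trans ?_⟩
    rcases hA with rfl | rfl | rfl <;> simp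

theorem edges_updLR {G : Game} {u v : ℕ} (htwin : ∀ e ∈ G.EL ∪ G.ER, u ∈ e ↔ v ∈ e)
    (p : Player) : (updLR G u v).edges p = (G.edges p).filter fun e => u ∉ e := by
  cases p
  · exact image_erase_filter_twins fun e he => htwin e (Finset.mem_union_left _ he)
  · have h : ∀ e ∈ G.ER, u ∈ e ↔ v ∈ e := fun e he => htwin e (Finset.mem_union_right _ he)
    refine (image_erase_filter_twins fun e he => (h e he).symm).trans ?_
    exact Finset.filter_congr fun e he => (h e he).not.symm

theorem force_of_force_updLR {G : Game} {u v : ℕ} (hu : u ∈ G.V) (hv : v ∈ G.V) (huv : u ≠ v)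
    {T P T' P' : Finset ℕ → Finset ℕ → Prop} (hT : TwinInvariant u v T T')
    (hP : TwinInvariant u v P P') (t : Bool)
    (H : Force (updLR G u v).V T' P' (updLR G u v).V.card t ∅ ∅) :
    Force G.V T P G.V.card t ∅ ∅ := by
  have hcard : G.V.card = (updLR G u v).V.card + 2 := by
    have h1 := Finset.card_erase_add_one hu
    have h2 := Finset.card_erase_add_one (Finset.mem_erase.2 ⟨huv.symm, hv⟩)
    simp only [updLR]
    omega
  rw [hcard]
  refine force_of_force_erase_twins hT hP hu hv huv _ t (by simp) (by simp) (by simp) (by simp)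
    ?_ H
  exact Finset.card_le_card Finset.sdiff_subset

theorem fills_edges_updLR {G : Game} {u v : ℕ} (huv : u ≠ v)
    (htwin : ∀ e ∈ G.EL ∪ G.ER, u ∈ e ↔ v ∈ e) (p : Player) {A A₁ : Finset ℕ}
    (hu : u ∉ A) (hv : v ∉ A) (hA : A₁ = A ∨ A₁ = insert u A ∨ A₁ = insert v A) :
    fills (G.edges p) A₁ ↔ fills ((updLR G u v).edges p) A := by
  rw [edges_updLR htwin]
  refine fills_filter_twins huv (fun e he => htwin e ?_) hu hv hA
  cases p
  · exact Finset.mem_union_left _ he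
  · exact Finset.mem_union_right _ he

theorem twinInvariant_over {G : Game} {u v : ℕ} (huv : u ≠ v)
    (htwin : ∀ e ∈ G.EL ∪ G.ER, u ∈ e ↔ v ∈ e) (p : Player) :
    TwinInvariant u v (Over (G.edges p) (G.edges p.other))
      (Over ((updLR G u v).edges p) ((updLR G u v).edges p.other)) :=
  fun _ _ _ _ h1 h2 h3 h4 hA hB =>
    or_congr (fills_edges_updLR huv htwin p h1 h2 hA) (fills_edges_updLR huv htwin _ h3 h4 hB)

theorem winsAs_of_updLR {G : Game} {u v : ℕ} (hu : u ∈ G.V) (hv : v ∈ G.V) (huv : u ≠ v)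
    (htwin : ∀ e ∈ G.EL ∪ G.ER, u ∈ e ↔ v ∈ e) (s p : Player) (H : WinsAs (updLR G u v) s p) :
    WinsAs G s p := by
  rw [winsAs_iff_force] at H ⊢
  exact force_of_force_updLR hu hv huv (twinInvariant_over huv htwin p)
    (fun _ _ _ _ h1 h2 _ _ hA _ => fills_edges_updLR huv htwin p h1 h2 hA) _ H

theorem nonLosingAs_of_updLR {G : Game} {u v : ℕ} (hu : u ∈ G.V) (hv : v ∈ G.V) (huv : u ≠ v)
    (htwin : ∀ e ∈ G.EL ∪ G.ER, u ∈ e ↔ v ∈ e) (s p : Player)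
    (H : NonLosingAs (updLR G u v) s p) : NonLosingAs G s p := by
  rw [nonLosingAs_iff_force] at H ⊢
  exact force_of_force_updLR hu hv huv (twinInvariant_over huv htwin p)
    (fun _ _ _ _ _ _ h3 h4 _ hB => (fills_edges_updLR huv htwin p.other h3 h4 hB).not) _ H

theorem winsAs_updLR_iff {G : Game} {u v : ℕ} (hu : u ∈ G.V) (hv : v ∈ G.V) (huv : u ≠ v)
    (htwin : ∀ e ∈ G.EL ∪ G.ER, u ∈ e ↔ v ∈ e) (s p : Player) :
    WinsAs (updLR G u v) s p ↔ WinsAs G s p := by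
  refine ⟨winsAs_of_updLR hu hv huv htwin s p, fun H => ?_⟩
  by_contra hn
  exact (not_winsAs_iff G s p).2
    (nonLosingAs_of_updLR hu hv huv htwin s p.other ((not_winsAs_iff _ s p).1 hn)) H

theorem nonLosingAs_updLR_iff {G : Game} {u v : ℕ} (hu : u ∈ G.V) (hv : v ∈ G.V) (huv : u ≠ v)
    (htwin : ∀ e ∈ G.EL ∪ G.ER, u ∈ e ↔ v ∈ e) (s p : Player) :
    NonLosingAs (updLR G u v) s p ↔ NonLosingAs G s p := by
  rw [← Player.other_other p, ← not_winsAs_iff, ← not_winsAs_iff,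
    winsAs_updLR_iff hu hv huv htwin]

theorem updLR_comm_of_twins {G : Game} {u v : ℕ} (htwin : ∀ e ∈ G.EL ∪ G.ER, u ∈ e ↔ v ∈ e) :
    updLR G u v = updLR G v u := by
  have hedges : ∀ p, (updLR G u v).edges p = (updLR G v u).edges p := by
    intro p
    rw [edges_updLR htwin, edges_updLR fun e he => (htwin e he).symm]
    refine Finset.filter_congr fun e he => (htwin e ?_).not
    cases p
    · exact Finset.mem_union_left _ he
    · exact Finset.mem_union_right _ he
  have hV : (updLR G u v).V = (updLR G v u).V := Finset.erase_right_comm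
  exact (Game.mk.injEq ..).mpr ⟨hV, hedges .L, hedges .R⟩

/-- Twin simplification: if `u` and `v` appear in exactly the same edges, then the
updated games `G_u^v` and `G_v^u` coincide and have the same outcome as `G`. -/
theorem twin_simplification (G : Game) (hG : WellFormed G) (u v : ℕ)
    (hu : u ∈ G.V) (hv : v ∈ G.V) (huv : u ≠ v)
    (hsu : ({u} : Finset ℕ) ∉ G.EL ∪ G.ER) (hsv : ({v} : Finset ℕ) ∉ G.EL ∪ G.ER)
    (htwin : ∀ e ∈ G.EL ∪ G.ER, u ∈ e ↔ v ∈ e) :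
    updLR G u v = updLR G v u ∧ ∀ o : Outcome, hasOutcome (updLR G u v) o ↔ hasOutcome G o := by
  refine ⟨updLR_comm_of_twins htwin, fun o => ?_⟩
  have hres : ∀ s r, resultIs (updLR G u v) s r ↔ resultIs G s r := by
    intro s r
    cases r
    · exact winsAs_updLR_iff hu hv huv htwin s .L
    · exact and_congr (nonLosingAs_updLR_iff hu hv huv htwin s .L)
        (nonLosingAs_updLR_iff hu hv huv htwin s .R)
    · exact winsAs_updLR_iff hu hv huv htwin s .R
  exact and_congr (hres .L o.1) (hres .R o.2)
end APG
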